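/- Let σ > 0 and let x ∈ (0,1) be irrational. If B_σ(x) < +∞, then x is Diophantine of exponent σ: there exists γ > 0 such that |x − p/q| ≥ γ/q^{2+σ} for all integers p and all positive integers q. -/

import Mathlib

open Real Set MeasureTheory
open scoped ENNReal

/-- The Gauss map `A(x) = 1/x - ⌊1/x⌋`. -/
noncomputable def gaussMap (x : ℝ) : ℝ := 1 / x - (⌊1 / x⌋ : ℝ)

/-- `brjunoBeta x j = β_{j-1}(x) = ∏_{i=0}^{j-1} A^i(x)`; in particular
`brjunoBeta x 0 = β_{-1}(x) = 1` and `β_K(x) = brjunoBeta x (K+1)`. -/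
noncomputable def brjunoBeta (x : ℝ) (j : ℕ) : ℝ := ∏ i ∈ Finset.range j, gaussMap^[i] x

/-- The σ-Brjuno function `B_σ(x) = Σ_{j≥0} β_{j-1}(x) · (A^j x)^{-1/σ}`, valued in `[0,+∞]`. -/
noncomputable def brjuno (σ x : ℝ) : ℝ≥0∞ :=
  ∑' j : ℕ, ENNReal.ofReal (brjunoBeta x j * (gaussMap^[j] x) ^ (-(1 / σ)))

/-- The K-th partial sum `B_σ^{(K)}(x) = Σ_{j=0}^{K} β_{j-1}(x) · (A^j x)^{-1/σ}`. -/
noncomputable def brjunoPartial (σ x : ℝ) (K : ℕ) : ℝ :=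
  ∑ j ∈ Finset.range (K + 1), brjunoBeta x j * (gaussMap^[j] x) ^ (-(1 / σ))

/-- The fixed point `η_m = (√(m²+4) − m)/2 = [0; m, m, m, ...]` of the Gauss map. -/
noncomputable def eta (m : ℕ) : ℝ := (Real.sqrt ((m : ℝ) ^ 2 + 4) - m) / 2

/-- `b* = (σ+1)^{1+1/σ}/σ`. -/
noncomputable def bstar (σ : ℝ) : ℝ := (σ + 1) ^ (1 + 1 / σ) / σ

/-- The global lower bound `g(x) = x^{-1/σ} + b*·x`. -/
noncomputable def gLow (σ x : ℝ) : ℝ := x ^ (-(1 / σ)) + bstar σ * x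

/-- The cylinder lower bound `g_k(x) = x^{-1/σ} + x·(1/x − k)^{-1/σ} + (1 − kx)·b*`. -/
noncomputable def gCyl (σ : ℝ) (k : ℕ) (x : ℝ) : ℝ :=
  x ^ (-(1 / σ)) + x * (1 / x - (k : ℝ)) ^ (-(1 / σ)) + (1 - (k : ℝ) * x) * bstar σ

/-- The three-term recurrence `f (n + 2) = f n + aₙ f (n + 1)` driven by the partial quotients
`aₙ = ⌊1 / Aⁿ x⌋`, with initial values `s` and `t`. The denominators of the convergents of `x` are
obtained from `(0, 1)` and the numerators from `(1, 0)`. -/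
noncomputable def gaussContinuant (x : ℝ) (s t : ℤ) : ℕ → ℤ
  | 0 => s
  | 1 => t
  | n + 2 => gaussContinuant x s t n + ⌊1 / gaussMap^[n] x⌋ * gaussContinuant x s t (n + 1)

theorem gaussMap_iterate_irrational {x : ℝ} (hx : Irrational x) (hx01 : x ∈ Set.Ioo (0 : ℝ) 1)
    (n : ℕ) : Irrational (gaussMap^[n] x) ∧ gaussMap^[n] x ∈ Set.Ioo (0 : ℝ) 1 := by
  induction n with
  | zero => exact ⟨hx, hx01⟩
  | succ n ih =>
    rw [Function.iterate_succ_apply']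
    set y := gaussMap^[n] x
    have h : Irrational (gaussMap y) := by
      have h1 : Irrational (1 / y) := by simpa using ih.1.inv
      exact h1.sub_intCast _
    refine ⟨h, lt_of_le_of_ne ?_ h.ne_zero.symm, ?_⟩
    · exact sub_nonneg.2 (Int.floor_le _)
    · exact Int.fract_lt_one (1 / y)

theorem one_le_floor_inv_gaussMap_iterate {x : ℝ} (hx : Irrational x)
    (hx01 : x ∈ Set.Ioo (0 : ℝ) 1) (n : ℕ) : 1 ≤ ⌊1 / gaussMap^[n] x⌋ := by
  obtain ⟨-, h0, h1⟩ := gaussMap_iterate_irrational hx hx01 n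
  rw [Int.le_floor, Int.cast_one]
  exact (one_le_div h0).2 h1.le

theorem brjunoBeta_succ (x : ℝ) (n : ℕ) :
    brjunoBeta x (n + 1) = brjunoBeta x n * gaussMap^[n] x :=
  Finset.prod_range_succ _ _

theorem brjunoBeta_pos {x : ℝ} (hx : Irrational x) (hx01 : x ∈ Set.Ioo (0 : ℝ) 1) (n : ℕ) :
    0 < brjunoBeta x n :=
  Finset.prod_pos fun i _ => (gaussMap_iterate_irrational hx hx01 i).2.1

theorem brjunoBeta_succ_le {x : ℝ} (hx : Irrational x) (hx01 : x ∈ Set.Ioo (0 : ℝ) 1) (n : ℕ) :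
    brjunoBeta x (n + 1) ≤ brjunoBeta x n := by
  rw [brjunoBeta_succ]
  exact mul_le_of_le_one_right (brjunoBeta_pos hx hx01 n).le
    (gaussMap_iterate_irrational hx hx01 n).2.2.le

theorem brjunoBeta_add_two {x : ℝ} (hx : Irrational x) (hx01 : x ∈ Set.Ioo (0 : ℝ) 1) (n : ℕ) :
    brjunoBeta x (n + 2) =
      brjunoBeta x n - ⌊1 / gaussMap^[n] x⌋ * brjunoBeta x (n + 1) := by
  have h0 := (gaussMap_iterate_irrational hx hx01 n).2.1.ne'
  rw [brjunoBeta_succ x (n + 1), brjunoBeta_succ x n, Function.iterate_succ_apply']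
  set y := gaussMap^[n] x
  have h : y * gaussMap y = 1 - ⌊1 / y⌋ * y := by
    rw [gaussMap, mul_sub, mul_one_div_cancel h0, mul_comm y]
  rw [mul_assoc, h]
  ring

theorem gaussContinuant_mul_sub {x : ℝ} (hx : Irrational x) (hx01 : x ∈ Set.Ioo (0 : ℝ) 1)
    (n : ℕ) : (gaussContinuant x 0 1 n : ℝ) * x - gaussContinuant x 1 0 n =
      (-1) ^ (n + 1) * brjunoBeta x n := by
  induction n using Nat.twoStepInduction with
  | zero => simp [gaussContinuant, brjunoBeta]
  | one => simp [gaussContinuant, brjunoBeta]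
  | more n h1 h2 =>
    rw [brjunoBeta_add_two hx hx01]
    simp only [gaussContinuant, Int.cast_add, Int.cast_mul]
    linear_combination h1 + (⌊1 / gaussMap^[n] x⌋ : ℝ) * h2

theorem brjunoBeta_mul_gaussContinuant_add {x : ℝ} (hx : Irrational x)
    (hx01 : x ∈ Set.Ioo (0 : ℝ) 1) (n : ℕ) :
    brjunoBeta x n * gaussContinuant x 0 1 (n + 1) +
      brjunoBeta x (n + 1) * gaussContinuant x 0 1 n = 1 := by
  induction n with
  | zero => simp [gaussContinuant, brjunoBeta]
  | succ n ih =>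
    rw [brjunoBeta_add_two hx hx01]
    simp only [gaussContinuant, Int.cast_add, Int.cast_mul]
    linear_combination ih

theorem gaussContinuant_nonneg_and_le_succ {x : ℝ} (hx : Irrational x)
    (hx01 : x ∈ Set.Ioo (0 : ℝ) 1) (n : ℕ) :
    0 ≤ gaussContinuant x 0 1 n ∧ gaussContinuant x 0 1 n ≤ gaussContinuant x 0 1 (n + 1) := by
  induction n with
  | zero => simp [gaussContinuant]
  | succ n ih =>
    have ha := one_le_floor_inv_gaussMap_iterate hx hx01 n
    refine ⟨ih.1.trans ih.2, ?_⟩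
    simp only [gaussContinuant]
    nlinarith

theorem one_le_and_natCast_le_gaussContinuant_succ {x : ℝ} (hx : Irrational x)
    (hx01 : x ∈ Set.Ioo (0 : ℝ) 1) (n : ℕ) : 1 ≤ gaussContinuant x 0 1 (n + 1) ∧ (n : ℤ) ≤ gaussContinuant x 0 1 (n + 1) := by
  induction n using Nat.twoStepInduction with
  | zero => simp [gaussContinuant]
  | one =>
    have ha := one_le_floor_inv_gaussMap_iterate hx hx01 0
    simpa [gaussContinuant] using ha
  | more n h1 h2 =>
    have ha := one_le_floor_inv_gaussMap_iterate hx hx01 (n + 1)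
    rw [show gaussContinuant x 0 1 (n + 2 + 1) = gaussContinuant x 0 1 (n + 1) +
      ⌊1 / gaussMap^[n + 1] x⌋ * gaussContinuant x 0 1 (n + 1 + 1) from rfl]
    push_cast at h2 ⊢
    constructor <;> nlinarith

theorem exists_eq_gaussContinuant_combination (x : ℝ) (p q : ℤ) (n : ℕ) :
    ∃ u v : ℤ, q = u * gaussContinuant x 0 1 n + v * gaussContinuant x 0 1 (n + 1) ∧
      p = u * gaussContinuant x 1 0 n + v * gaussContinuant x 1 0 (n + 1) := by
  induction n with
  | zero => exact ⟨p, q, by simp [gaussContinuant], by simp [gaussContinuant]⟩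
  | succ n ih =>
    obtain ⟨u, v, hq, hp⟩ := ih
    refine ⟨v - ⌊1 / gaussMap^[n] x⌋ * u, u, ?_, ?_⟩
    · rw [hq, gaussContinuant]
      ring
    · rw [hp, gaussContinuant]
      ring

/-- The convergents are best approximations of the second kind. -/
theorem brjunoBeta_le_abs_mul_sub {x : ℝ} (hx : Irrational x) (hx01 : x ∈ Set.Ioo (0 : ℝ) 1)
    {n : ℕ} {p q : ℤ} (hq : 0 < q) (hqn : q < gaussContinuant x 0 1 (n + 1)) :
    brjunoBeta x n ≤ |q * x - p| := by
  obtain ⟨u, v, hu, hv⟩ := exists_eq_gaussContinuant_combination x p q n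
  have e1 := gaussContinuant_mul_sub hx hx01 n
  have e2 := gaussContinuant_mul_sub hx hx01 (n + 1)
  have hb := brjunoBeta_pos hx hx01 n
  have hb' := brjunoBeta_pos hx hx01 (n + 1)
  have hQ := (gaussContinuant_nonneg_and_le_succ hx hx01 n).1
  have hval : (q : ℝ) * x - p =
      (-1) ^ (n + 1) * (u * brjunoBeta x n - v * brjunoBeta x (n + 1)) := by
    rw [hu, hv]
    push_cast
    linear_combination (u : ℝ) * e1 + (v : ℝ) * e2
  rw [hval, abs_mul, abs_pow, abs_neg, abs_one, one_pow, one_mul]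
  rcases lt_trichotomy u 0 with h | h | h
  · have h2 : 0 ≤ v := by
      by_contra! hneg
      nlinarith
    have h' : (u : ℝ) ≤ -1 := by exact_mod_cast Int.le_sub_one_of_lt h
    have h2' : (0 : ℝ) ≤ v := by exact_mod_cast h2
    refine le_trans ?_ (neg_le_abs _)
    nlinarith
  · subst h
    exfalso
    rcases le_or_gt v 0 with h2 | h2 <;> nlinarith
  · have h2 : v ≤ 0 := by
      by_contra! hpos
      nlinarith
    have h' : (1 : ℝ) ≤ u := by exact_mod_cast h
    have h2' : (v : ℝ) ≤ 0 := by exact_mod_cast h2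
    refine le_trans ?_ (le_abs_self _)
    nlinarith

theorem exists_gaussContinuant_le_lt {x : ℝ} (hx : Irrational x) (hx01 : x ∈ Set.Ioo (0 : ℝ) 1)
    {q : ℕ} (hq : 0 < q) :
    ∃ m, gaussContinuant x 0 1 (m + 1) ≤ q ∧ q < gaussContinuant x 0 1 (m + 2) := by
  classical
  have hex : ∃ n, (q : ℤ) < gaussContinuant x 0 1 (n + 1) :=
    ⟨q + 1, by
      have := (one_le_and_natCast_le_gaussContinuant_succ hx hx01 (q + 1)).2
      push_cast at this
      linarith⟩
  obtain ⟨m, hm⟩ : ∃ m, Nat.find hex = m + 1 := by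
    refine Nat.exists_eq_succ_of_ne_zero fun h => ?_
    have := Nat.find_spec hex
    rw [h] at this
    simp only [gaussContinuant] at this
    omega
  refine ⟨m, not_lt.1 (Nat.find_min hex (by omega)), ?_⟩
  have := Nat.find_spec hex
  rwa [hm] at this

theorem one_le_two_mul_gaussContinuant_mul_brjunoBeta {x : ℝ} (hx : Irrational x)
    (hx01 : x ∈ Set.Ioo (0 : ℝ) 1) (n : ℕ) :
    1 ≤ 2 * gaussContinuant x 0 1 (n + 1) * brjunoBeta x n := by
  have h := brjunoBeta_mul_gaussContinuant_add hx hx01 n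
  obtain ⟨h0, h1⟩ := gaussContinuant_nonneg_and_le_succ hx hx01 n
  have h0' : (0 : ℝ) ≤ gaussContinuant x 0 1 n := by exact_mod_cast h0
  have h1' : (gaussContinuant x 0 1 n : ℝ) ≤ gaussContinuant x 0 1 (n + 1) := by
    exact_mod_cast h1
  have := mul_le_mul (brjunoBeta_succ_le hx hx01 n) h1' h0' (brjunoBeta_pos hx hx01 n).le
  linarith

/-- A bound on the terms of the Brjuno series controls the decay of `β`. -/
theorem rpow_brjunoBeta_le {σ x B : ℝ} (hσ : 0 < σ) (hx : Irrational x)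
    (hx01 : x ∈ Set.Ioo (0 : ℝ) 1) (n : ℕ)
    (hB : brjunoBeta x n * (gaussMap^[n] x) ^ (-(1 / σ)) ≤ B) :
    brjunoBeta x n ^ (1 + σ) ≤ B ^ σ * brjunoBeta x (n + 1) := by
  have hb := brjunoBeta_pos hx hx01 n
  have hy := (gaussMap_iterate_irrational hx hx01 n).2.1
  have h := Real.rpow_le_rpow (by positivity) hB hσ.le
  rw [Real.mul_rpow hb.le (by positivity), ← Real.rpow_mul hy.le,
    show -(1 / σ) * σ = -1 by field_simp, Real.rpow_neg_one, ← div_eq_mul_inv,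
    div_le_iff₀ hy] at h
  rw [Real.rpow_add hb, Real.rpow_one, brjunoBeta_succ]
  calc brjunoBeta x n * brjunoBeta x n ^ σ
      ≤ brjunoBeta x n * (B ^ σ * gaussMap^[n] x) := by gcongr
    _ = B ^ σ * (brjunoBeta x n * gaussMap^[n] x) := by ring

/-- σ-Brjuno numbers are Diophantine of exponent `σ`. -/
theorem brjuno_implies_diophantine (σ : ℝ) (hσ : 0 < σ) (x : ℝ) (hx : Irrational x)
    (hx01 : x ∈ Set.Ioo (0 : ℝ) 1) (hfin : brjuno σ x < ⊤) :
    ∃ γ : ℝ, 0 < γ ∧ ∀ (p : ℤ) (q : ℕ), 0 < q →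
      γ / (q : ℝ) ^ ((2 : ℝ) + σ) ≤ |x - (p : ℝ) / (q : ℝ)| := by
  obtain ⟨B, hB0, hB⟩ : ∃ B : ℝ, 0 < B ∧
      ∀ n, brjunoBeta x n * (gaussMap^[n] x) ^ (-(1 / σ)) ≤ B := by
    refine ⟨(brjuno σ x).toReal + 1, by positivity, fun n => ?_⟩
    have h : ENNReal.ofReal (brjunoBeta x n * (gaussMap^[n] x) ^ (-(1 / σ))) ≤ brjuno σ x :=
      ENNReal.le_tsum n
    linarith [(ENNReal.ofReal_le_iff_le_toReal hfin.ne).1 h]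
  refine ⟨(2 ^ (1 + σ) * B ^ σ)⁻¹, by positivity, fun p q hq => ?_⟩
  have hq0 : (0 : ℝ) < q := by exact_mod_cast hq
  obtain ⟨m, hm1, hm2⟩ := exists_gaussContinuant_le_lt hx hx01 hq
  have hb := brjunoBeta_pos hx hx01 m
  have happrox : brjunoBeta x (m + 1) ≤ |(q : ℝ) * x - p| := by
    simpa using brjunoBeta_le_abs_mul_sub hx hx01 (p := p) (by exact_mod_cast hq) hm2
  have hQ : (gaussContinuant x 0 1 (m + 1) : ℝ) ≤ q := by exact_mod_cast hm1
  have h1 : 1 ≤ 2 * q * brjunoBeta x m :=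
    (one_le_two_mul_gaussContinuant_mul_brjunoBeta hx hx01 m).trans (by gcongr)
  have h2 : 1 ≤ 2 ^ (1 + σ) * (q : ℝ) ^ (1 + σ) * brjunoBeta x m ^ (1 + σ) := by
    have := Real.one_le_rpow h1 (by positivity : 0 ≤ 1 + σ)
    rwa [Real.mul_rpow (by positivity) hb.le, Real.mul_rpow (by positivity) hq0.le] at this
  have habs : |x - (p : ℝ) / q| = |(q : ℝ) * x - p| / q := by
    rw [← abs_of_pos hq0, ← abs_div, abs_of_pos hq0]
    congr 1
    field_simp
  rw [habs, show (2 : ℝ) + σ = (1 + σ) + 1 by ring, Real.rpow_add hq0, Real.rpow_one,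
    ← div_div]
  gcongr
  rw [div_le_iff₀ (by positivity), inv_le_iff_one_le_mul₀' (by positivity)]
  calc 1 ≤ 2 ^ (1 + σ) * (q : ℝ) ^ (1 + σ) * brjunoBeta x m ^ (1 + σ) := h2
    _ ≤ 2 ^ (1 + σ) * (q : ℝ) ^ (1 + σ) * (B ^ σ * |(q : ℝ) * x - p|) := by
        gcongr
        exact (rpow_brjunoBeta_le hσ hx hx01 m (hB m)).trans (by gcongr)
    _ = _ := by ring
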